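/- arXiv:1801.00380 — 2 statements merged into one kernel-verified Lean document; each statement's English description precedes it below -/
import Mathlib

section
/- Let λ ≥ 0, ν > 0, τ > 0, let Σ̂₁, …, Σ̂_M be real symmetric p×p matrices with average Σ̄, and suppose there exists a KKT point (Σ̂⁺, Φ̂⁺, Λ̂⁺) for the constrained problem min{(1/(2M))Σ_k‖Σ − Σ̂_k‖²_F + λ|Σ|₁ : Σ = Φ, Φ ⪰ νI}. Then from any symmetric starting point (Σ⁰, Λ⁰), the ADMM sequence defined by Φ^{i+1} = (Σⁱ + τΛⁱ)₊, Σ^{i+1} = s(τ(Σ̄ − Λⁱ) + Φ^{i+1}, λτ)/(τ + 1), Λ^{i+1} = Λⁱ − (1/τ)(Φ^{i+1} − Σ^{i+1}) converges to a limit (Σ*, Φ*, Λ*) with Φ* = Σ*, Σ* ⪰ νI, and Σ* minimizes (1/(2M))Σ_{k=1}^M ‖Σ − Σ̂_k‖²_F + λ|Σ|₁ over all symmetric Σ with Σ ⪰ νI. -/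
open Matrix Filter Topology

/-- The Frobenius norm of a real `p × p` matrix. -/
noncomputable def frobNorm {p : ℕ} (A : Matrix (Fin p) (Fin p) ℝ) : ℝ :=
  Real.sqrt (∑ i, ∑ j, (A i j) ^ 2)

/-- The L1 norm of the off-diagonal entries: `|Σ|₁ = ∑_{i ≠ j} |σ_{ij}|`. -/
noncomputable def offDiagL1 {p : ℕ} (A : Matrix (Fin p) (Fin p) ℝ) : ℝ :=
  ∑ i, ∑ j, if i = j then 0 else |A i j|

/-- The trace inner product `⟨A, B⟩ = ∑ i j, A i j * B i j`. -/
def matInner {p : ℕ} (A B : Matrix (Fin p) (Fin p) ℝ) : ℝ :=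
  ∑ i, ∑ j, A i j * B i j

/-- The elementwise soft-threshold operator: off the diagonal
`s(z, δ) = sign(z) * max(|z| − δ, 0)`, and the diagonal is left unchanged. -/
noncomputable def softThresh {p : ℕ} (Z : Matrix (Fin p) (Fin p) ℝ) (δ : ℝ) :
    Matrix (Fin p) (Fin p) ℝ :=
  Matrix.of fun i j =>
    if i = j then Z i j else Real.sign (Z i j) * max (|Z i j| - δ) 0

/-- `IsClip ν Z W` says that `W = (Z)₊`: there is an orthonormal spectral decomposition
`Z = ∑ i, lam i • ξ i (ξ i)ᵀ` such that `W = ∑ i, max (lam i) ν • ξ i (ξ i)ᵀ`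
(the eigenvalue-clipping of `Z` at level `ν`). -/
def IsClip {p : ℕ} (ν : ℝ) (Z W : Matrix (Fin p) (Fin p) ℝ) : Prop :=
  ∃ (lam : Fin p → ℝ) (ξ : Fin p → (Fin p → ℝ)),
    (∀ i j : Fin p, ξ i ⬝ᵥ ξ j = if i = j then (1 : ℝ) else 0) ∧
    Z = ∑ i, lam i • Matrix.vecMulVec (ξ i) (ξ i) ∧
    W = ∑ i, max (lam i) ν • Matrix.vecMulVec (ξ i) (ξ i)

/-- The squared `J`-norm of a pair `(Λ, Σ)`: `‖(Λ, Σ)‖²_J = τ‖Λ‖²_F + τ⁻¹‖Σ‖²_F`. -/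
noncomputable def JnormSq {p : ℕ} (τ : ℝ) (L S : Matrix (Fin p) (Fin p) ℝ) : ℝ :=
  τ * (frobNorm L) ^ 2 + τ⁻¹ * (frobNorm S) ^ 2


section helpers

open scoped InnerProductSpace

variable {E : Type*} [NormedAddCommGroup E] [InnerProductSpace ℝ E]

/-- Monotonicity of the (strongly monotone) subgradient relation. -/
lemma aux_mono (h : E → ℝ) (B S L S' L' : E)
    (h1 : ∀ T, ⟪B - L - S, T - S⟫_ℝ ≤ h T - h S)
    (h2 : ∀ T, ⟪B - L' - S', T - S'⟫_ℝ ≤ h T - h S') :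
    ⟪L - L', S - S'⟫_ℝ + ‖S - S'‖ ^ 2 ≤ 0 := by
  have a := h1 S'
  have b := h2 S
  have e : ⟪L - L', S - S'⟫_ℝ + ‖S - S'‖ ^ 2
      = ⟪B - L - S, S' - S⟫_ℝ + ⟪B - L' - S', S - S'⟫_ℝ := by
    rw [← real_inner_self_eq_norm_sq]
    simp only [inner_sub_left, inner_sub_right]
    ring
  linarith

lemma aux_step (C : Set E) (h : E → ℝ) (B : E) (τ : ℝ) (hτ : 0 < τ)
    (S L S' L' P' Sp Lp : E)
    (h1 : ∀ T, ⟪B - L - S, T - S⟫_ℝ ≤ h T - h S)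
    (h2 : ∀ T, ⟪B - L' - S', T - S'⟫_ℝ ≤ h T - h S')
    (h3 : ∀ T, ⟪B - Lp - Sp, T - Sp⟫_ℝ ≤ h T - h Sp)
    (hP : P' ∈ C) (hproj : ∀ Φ ∈ C, ⟪τ • L' + S - S', Φ - P'⟫_ℝ ≤ 0)
    (hPe : P' = S' + τ • (L - L'))
    (hSp : Sp ∈ C) (hLp : ∀ Φ ∈ C, ⟪Lp, Φ - Sp⟫_ℝ ≤ 0) :
    τ ^ 2 * ‖L' - Lp‖ ^ 2 + ‖S' - Sp‖ ^ 2 + (2 * τ * ‖S' - Sp‖ ^ 2 + τ ^ 2 * ‖L - L'‖ ^ 2)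
      ≤ τ ^ 2 * ‖L - Lp‖ ^ 2 + ‖S - Sp‖ ^ 2 := by
  have m1 := aux_mono h B S L S' L' h1 h2
  have m2 := aux_mono h B S' L' Sp Lp h2 h3
  have p1 := hproj Sp hSp
  have p2 := hLp P' hP
  obtain ⟨l, hl⟩ : ∃ l, l = L' - Lp := ⟨_, rfl⟩
  obtain ⟨s, hs⟩ : ∃ s, s = S' - Sp := ⟨_, rfl⟩
  obtain ⟨dl, hdl⟩ : ∃ dl, dl = L - L' := ⟨_, rfl⟩
  obtain ⟨ds, hds⟩ : ∃ ds, ds = S - S' := ⟨_, rfl⟩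
  have e1 : L - Lp = l + dl := by rw [hl, hdl]; abel
  have e2 : S - Sp = s + ds := by rw [hs, hds]; abel
  have p3 : 0 ≤ ⟪τ • l + ds, s + τ • dl⟫_ℝ := by
    have : ⟪τ • l + ds, s + τ • dl⟫_ℝ
        = - ⟪τ • L' + S - S', Sp - P'⟫_ℝ - τ * ⟪Lp, P' - Sp⟫_ℝ := by
      rw [hPe, hl, hs, hdl, hds]
      simp only [inner_sub_left, inner_sub_right, inner_add_left, inner_add_right,
        real_inner_smul_left, real_inner_smul_right]
      ring
    rw [this]
    nlinarith
  rw [e1, e2, ← hl, ← hs, ← hdl, norm_add_sq_real, norm_add_sq_real]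
  rw [← hdl, ← hds] at m1
  rw [← hl, ← hs] at m2
  simp only [inner_add_left, inner_add_right,
        real_inner_smul_left, real_inner_smul_right] at p3
  have c1 : ⟪dl, ds⟫_ℝ = ⟪ds, dl⟫_ℝ := real_inner_comm _ _
  have c2 : ⟪s, ds⟫_ℝ = ⟪ds, s⟫_ℝ := real_inner_comm _ _
  rw [c1] at m1
  rw [c2]
  have n1 := mul_le_mul_of_nonneg_left m1 hτ.le
  have n2 := mul_le_mul_of_nonneg_left m2 hτ.le
  nlinarith [sq_nonneg ‖ds‖, mul_nonneg hτ.le (sq_nonneg ‖ds‖)]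

/-- A nonincreasing-type sequence forces its decrements to zero. -/
lemma aux_decr (V d : ℕ → ℝ) (hV : ∀ i, 0 ≤ V i) (hd : ∀ i, 0 ≤ d i)
    (hs : ∀ i, V (i + 1) + d i ≤ V i) : Tendsto d atTop (𝓝 0) := by
  have anti : Antitone V := antitone_nat_of_succ_le fun i => by linarith [hs i, hd i]
  have hlim := tendsto_atTop_ciInf anti ⟨0, by rintro _ ⟨i, rfl⟩; exact hV i⟩
  have h2 := hlim.sub ((tendsto_add_atTop_iff_nat 1).2 hlim)
  rw [sub_self] at h2
  exact squeeze_zero hd (fun i => by linarith [hs i]) h2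

lemma aux_sq (x : ℕ → E) (c : ℝ) (hc : 0 < c) 
    (h : Tendsto (fun i => c * ‖x i‖ ^ 2) atTop (𝓝 0)) : Tendsto x atTop (𝓝 0) := by
  rw [tendsto_zero_iff_norm_tendsto_zero]
  have h1 := (h.const_mul c⁻¹).sqrt
  simp only [mul_zero, Real.sqrt_zero] at h1
  refine h1.congr fun i => ?_
  rw [inv_mul_cancel_left₀ hc.ne', Real.sqrt_sq (norm_nonneg _)]

lemma aux_abs [FiniteDimensional ℝ E] (C : Set E) (h : E → ℝ) (hcont : Continuous h)
    (B : E) (τ : ℝ) (hτ : 0 < τ) (S L P : ℕ → E) (Sp Lp : E)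
    (h1 : ∀ i T, ⟪B - L i - S i, T - S i⟫_ℝ ≤ h T - h (S i))
    (h3 : ∀ T, ⟪B - Lp - Sp, T - Sp⟫_ℝ ≤ h T - h Sp)
    (hP : ∀ i, P (i + 1) ∈ C)
    (hproj : ∀ i, ∀ Φ ∈ C, ⟪τ • L (i + 1) + S i - S (i + 1), Φ - P (i + 1)⟫_ℝ ≤ 0)
    (hPe : ∀ i, P (i + 1) = S (i + 1) + τ • (L i - L (i + 1)))
    (hSp : Sp ∈ C) (hLp : ∀ Φ ∈ C, ⟪Lp, Φ - Sp⟫_ℝ ≤ 0) :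
    Tendsto S atTop (𝓝 Sp) ∧ Tendsto P atTop (𝓝 Sp) ∧ ∃ Ls, Tendsto L atTop (𝓝 Ls) := by
  have step := fun (Lq : E) (g3 : ∀ T, ⟪B - Lq - Sp, T - Sp⟫_ℝ ≤ h T - h Sp)
      (gL : ∀ Φ ∈ C, ⟪Lq, Φ - Sp⟫_ℝ ≤ 0) (i : ℕ) =>
    aux_step C h B τ hτ (S i) (L i) (S (i + 1)) (L (i + 1)) (P (i + 1)) Sp Lq
      (h1 i) (h1 (i + 1)) g3 (hP i) (hproj i) (hPe i) hSp gL
  have hd := aux_decr (fun i => τ ^ 2 * ‖L i - Lp‖ ^ 2 + ‖S i - Sp‖ ^ 2)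
    (fun i => 2 * τ * ‖S (i + 1) - Sp‖ ^ 2 + τ ^ 2 * ‖L i - L (i + 1)‖ ^ 2)
    (fun i => by positivity) (fun i => by positivity) (step Lp h3 hLp)
  have hS1 : Tendsto (fun i => S (i + 1) - Sp) atTop (𝓝 0) :=
    aux_sq _ (2 * τ) (by positivity) (squeeze_zero (fun i => by positivity)
      (fun i => le_add_of_nonneg_right (by positivity)) hd)
  have hL1 : Tendsto (fun i => L i - L (i + 1)) atTop (𝓝 0) :=
    aux_sq _ (τ ^ 2) (by positivity) (squeeze_zero (fun i => by positivity)
      (fun i => le_add_of_nonneg_left (by positivity)) hd)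
  have hS2 : Tendsto (fun i => S (i + 1)) atTop (𝓝 Sp) := tendsto_sub_nhds_zero_iff.1 hS1
  have hS : Tendsto S atTop (𝓝 Sp) := (tendsto_add_atTop_iff_nat 1).1 hS2
  have hP2 : Tendsto (fun i => P (i + 1)) atTop (𝓝 Sp) := by
    have := hS2.add (hL1.const_smul τ)
    rw [smul_zero, add_zero] at this
    exact this.congr fun i => (hPe i).symm
  refine ⟨hS, (tendsto_add_atTop_iff_nat 1).1 hP2, ?_⟩
  have antiV := fun Lq g3 gL => (antitone_nat_of_succ_le
    (f := fun i => τ ^ 2 * ‖L i - Lq‖ ^ 2 + ‖S i - Sp‖ ^ 2) fun i => by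
      have := step Lq g3 gL i
      have : 0 ≤ 2 * τ * ‖S (i + 1) - Sp‖ ^ 2 + τ ^ 2 * ‖L i - L (i + 1)‖ ^ 2 := by positivity
      linarith)
  have hbd : ∀ i, L i ∈ Metric.closedBall Lp
      (Real.sqrt ((τ ^ 2)⁻¹ * (τ ^ 2 * ‖L 0 - Lp‖ ^ 2 + ‖S 0 - Sp‖ ^ 2))) := by
    intro i
    rw [mem_closedBall_iff_norm]
    apply Real.le_sqrt_of_sq_le
    have h0 := antiV Lp h3 hLp (Nat.zero_le i)
    simp only at h0
    rw [le_inv_mul_iff₀ (by positivity)]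
    nlinarith [sq_nonneg ‖S i - Sp‖]
  obtain ⟨Ls, -, φ, hφ, hLs⟩ :=
    (isCompact_closedBall Lp _ : IsCompact (Metric.closedBall Lp
      (Real.sqrt ((τ ^ 2)⁻¹ * (τ ^ 2 * ‖L 0 - Lp‖ ^ 2 + ‖S 0 - Sp‖ ^ 2))))).tendsto_subseq hbd
  refine ⟨Ls, ?_⟩
  have hSφ : Tendsto (fun i => S (φ i)) atTop (𝓝 Sp) := hS.comp hφ.tendsto_atTop
  have hLφ : Tendsto (fun i => L (φ i)) atTop (𝓝 Ls) := hLs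
  have g3 : ∀ T, ⟪B - Ls - Sp, T - Sp⟫_ℝ ≤ h T - h Sp := by
    intro T
    refine le_of_tendsto_of_tendsto'
      (((tendsto_const_nhds.sub hLφ).sub hSφ).inner (tendsto_const_nhds.sub hSφ))
      (tendsto_const_nhds.sub ((hcont.tendsto Sp).comp hSφ)) fun i => h1 (φ i) T
  have hLφ1 : Tendsto (fun i => L (φ i + 1)) atTop (𝓝 Ls) := by
    have := hLφ.sub (hL1.comp hφ.tendsto_atTop)
    rw [sub_zero] at this
    refine this.congr fun i => ?_
    simp
  have gL : ∀ Φ ∈ C, ⟪Ls, Φ - Sp⟫_ℝ ≤ 0 := by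
    intro Φ hΦ
    have t := ((((hLφ1.const_smul τ).add hSφ).sub (hS2.comp hφ.tendsto_atTop)).inner
      ((tendsto_const_nhds (x := Φ)).sub (hP2.comp hφ.tendsto_atTop)) (𝕜 := ℝ))
    have := le_of_tendsto' t fun i => hproj (φ i) Φ hΦ
    rw [add_sub_cancel_right, real_inner_smul_left] at this
    by_contra hc
    push Not at hc
    nlinarith [mul_pos hτ hc]
  -- the Lyapunov function at the cluster point tends to zero
  have anti := antiV Ls g3 gL
  have hlim := tendsto_atTop_ciInf anti ⟨0, by rintro _ ⟨i, rfl⟩; positivity⟩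
  have hsub : Tendsto (fun i => τ ^ 2 * ‖L (φ i) - Ls‖ ^ 2 + ‖S (φ i) - Sp‖ ^ 2) atTop (𝓝 0) := by
    have := (((hLφ.sub_const Ls).norm.pow 2).const_mul (τ ^ 2)).add
      ((hSφ.sub_const Sp).norm.pow 2)
    simpa using this
  have hz := tendsto_nhds_unique (hlim.comp hφ.tendsto_atTop) hsub
  rw [hz] at hlim
  exact tendsto_sub_nhds_zero_iff.1 (aux_sq _ (τ ^ 2) (by positivity)
    (squeeze_zero (fun i => by positivity)
      (fun i => le_add_of_nonneg_right (by positivity)) hlim))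

end helpers

section matrixHelpers

open scoped InnerProductSpace

variable {p : ℕ}

/-- Vectorization of a matrix. -/
noncomputable def vecE (A : Matrix (Fin p) (Fin p) ℝ) : EuclideanSpace ℝ (Fin p × Fin p) :=
  WithLp.toLp 2 fun x => A x.1 x.2

/-- Inverse of the vectorization. -/
def matE (x : EuclideanSpace ℝ (Fin p × Fin p)) : Matrix (Fin p) (Fin p) ℝ :=
  Matrix.of fun i j => x (i, j)

lemma matE_vecE (A : Matrix (Fin p) (Fin p) ℝ) : matE (vecE A) = A := rfl
lemma vecE_matE (x : EuclideanSpace ℝ (Fin p × Fin p)) : vecE (matE x) = x := rfl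
lemma vecE_add (A B : Matrix (Fin p) (Fin p) ℝ) : vecE (A + B) = vecE A + vecE B := rfl
lemma vecE_sub (A B : Matrix (Fin p) (Fin p) ℝ) : vecE (A - B) = vecE A - vecE B := rfl
lemma vecE_smul (c : ℝ) (A : Matrix (Fin p) (Fin p) ℝ) : vecE (c • A) = c • vecE A := rfl

lemma inner_vecE (A B : Matrix (Fin p) (Fin p) ℝ) : ⟪vecE A, vecE B⟫_ℝ = matInner A B := by
  simp only [vecE, matInner, PiLp.inner_apply, Fintype.sum_prod_type]
  simp [mul_comm]

lemma norm_vecE (A : Matrix (Fin p) (Fin p) ℝ) : ‖vecE A‖ = frobNorm A := by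
  simp [vecE, frobNorm, EuclideanSpace.norm_eq, Fintype.sum_prod_type]

lemma tendsto_frob (X : ℕ → Matrix (Fin p) (Fin p) ℝ) (x : EuclideanSpace ℝ (Fin p × Fin p))
    (h : Tendsto (fun i => vecE (X i)) atTop (𝓝 x)) :
    Tendsto (fun i => frobNorm (X i - matE x)) atTop (𝓝 0) := by
  have := (tendsto_iff_norm_sub_tendsto_zero.1 h)
  refine this.congr fun i => ?_
  rw [← norm_vecE, vecE_sub, vecE_matE]

/-- Scalar subgradient inequality. -/
lemma scalar_sub (lam s g t : ℝ) (hlam : 0 ≤ lam)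
    (h : if s ≠ 0 then g = lam * Real.sign s else |g| ≤ lam) :
    g * (t - s) ≤ lam * |t| - lam * |s| := by
  split_ifs at h with hs
  · rcases lt_or_gt_of_ne hs with hs' | hs'
    · rw [Real.sign_of_neg hs'] at h
      rw [h, abs_of_neg hs']
      nlinarith [neg_abs_le t]
    · rw [Real.sign_of_pos hs'] at h
      rw [h, abs_of_pos hs']
      nlinarith [le_abs_self t]
  · push Not at hs
    subst hs
    have : g * t ≤ |g| * |t| := by rw [← abs_mul]; exact le_abs_self _
    have := mul_le_mul_of_nonneg_right h (abs_nonneg t)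
    simp
    linarith

/-- The soft threshold satisfies the scalar optimality condition. -/
lemma soft_scalar (lam τ z : ℝ) (hlam : 0 ≤ lam) (hτ : 0 < τ) :
    let s := (τ + 1)⁻¹ * (Real.sign z * max (|z| - lam * τ) 0)
    if s ≠ 0 then τ⁻¹ * (z - (τ + 1) * s) = lam * Real.sign s
      else |τ⁻¹ * (z - (τ + 1) * s)| ≤ lam := by
  intro s
  have hτ1 : 0 < τ + 1 := by linarith
  have hs : (τ + 1) * s = Real.sign z * max (|z| - lam * τ) 0 := by
    simp only [s]; rw [mul_inv_cancel_left₀ hτ1.ne']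
  have hlt : 0 ≤ lam * τ := by positivity
  by_cases hz : |z| ≤ lam * τ
  · have h0 : s = 0 := by simp only [s]; rw [max_eq_right (by linarith)]; simp
    simp only [h0]
    simp only [ne_eq, not_true_eq_false, if_false, mul_zero, sub_zero]
    rw [abs_mul, abs_of_pos (inv_pos.2 hτ), inv_mul_le_iff₀ hτ]
    linarith
  · push Not at hz
    rw [max_eq_left (by linarith)] at hs
    have hz0 : z ≠ 0 := by rintro rfl; simp at hz; linarith
    rcases lt_or_gt_of_ne hz0 with h | h
    · rw [Real.sign_of_neg h, abs_of_neg h] at hs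
      rw [abs_of_neg h] at hz
      have hsn : s < 0 := by
        by_contra hc
        push Not at hc
        nlinarith [mul_nonneg hτ1.le hc]
      rw [if_pos hsn.ne, Real.sign_of_neg hsn, hs]
      field_simp
      ring
    · rw [Real.sign_of_pos h, abs_of_pos h] at hs
      rw [abs_of_pos h] at hz
      have hsn : 0 < s := by
        by_contra hc
        push Not at hc
        nlinarith
      rw [if_pos hsn.ne', Real.sign_of_pos hsn, hs]
      field_simp
      ring

/-- Entrywise optimality implies the variational subgradient inequality. -/
lemma mat_sub (lam : ℝ) (hlam : 0 ≤ lam) (G S T : Matrix (Fin p) (Fin p) ℝ)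
    (hdiag : ∀ j, G j j = 0)
    (hoff : ∀ j l, j ≠ l →
      if S j l ≠ 0 then G j l = lam * Real.sign (S j l) else |G j l| ≤ lam) :
    matInner G (T - S) ≤ lam * offDiagL1 T - lam * offDiagL1 S := by
  simp only [matInner, offDiagL1, Finset.mul_sum, ← Finset.sum_sub_distrib]
  refine Finset.sum_le_sum fun j _ => Finset.sum_le_sum fun l _ => ?_
  by_cases h : j = l
  · subst h
    simp [hdiag]
  · simp only [h, if_false]
    exact scalar_sub lam _ _ _ hlam (hoff j l h)

lemma matInner_vec (ξ : Fin p → ℝ) (A : Matrix (Fin p) (Fin p) ℝ) :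
    matInner (Matrix.vecMulVec ξ ξ) A = ξ ⬝ᵥ (A *ᵥ ξ) := by
  simp only [matInner, Matrix.vecMulVec_apply, dotProduct, Matrix.mulVec, Finset.mul_sum]
  refine Finset.sum_congr rfl fun i _ => Finset.sum_congr rfl fun j _ => by ring

lemma matInner_sum_left (c : Fin p → ℝ) (X : Fin p → Matrix (Fin p) (Fin p) ℝ)
    (A : Matrix (Fin p) (Fin p) ℝ) :
    matInner (∑ i, c i • X i) A = ∑ i, c i * matInner (X i) A := by
  simp only [matInner, Matrix.sum_apply, Matrix.smul_apply, smul_eq_mul, Finset.sum_mul,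
    Finset.mul_sum]
  calc _ = ∑ a, ∑ i, ∑ b, c i * X i a b * A a b :=
        Finset.sum_congr rfl fun a _ => Finset.sum_comm
    _ = ∑ i, ∑ a, ∑ b, c i * X i a b * A a b := Finset.sum_comm
    _ = _ := by simp only [mul_assoc]

lemma sum_vecMulVec (ξ : Fin p → (Fin p → ℝ))
    (hξ : ∀ i j : Fin p, ξ i ⬝ᵥ ξ j = if i = j then (1 : ℝ) else 0) :
    ∑ i, Matrix.vecMulVec (ξ i) (ξ i) = (1 : Matrix (Fin p) (Fin p) ℝ) := by
  have h1 : (Matrix.of ξ) * (Matrix.of ξ)ᵀ = 1 := by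
    ext i j
    rw [Matrix.mul_apply, Matrix.one_apply, ← hξ i j]
    rfl
  have h2 := mul_eq_one_comm.1 h1
  rw [← h2]
  ext i j
  simp [Matrix.sum_apply, Matrix.vecMulVec_apply, Matrix.mul_apply]

lemma clip_mem (ν : ℝ) (Z W : Matrix (Fin p) (Fin p) ℝ) (h : IsClip ν Z W) :
    (W - ν • (1 : Matrix (Fin p) (Fin p) ℝ)).PosSemidef := by
  obtain ⟨l, ξ, hξ, -, rfl⟩ := h
  rw [← sum_vecMulVec ξ hξ, Finset.smul_sum, ← Finset.sum_sub_distrib]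
  refine Matrix.posSemidef_sum _ fun i _ => ?_
  rw [← sub_smul]
  refine Matrix.PosSemidef.smul ?_ (sub_nonneg.2 (le_max_right _ _))
  simpa using Matrix.posSemidef_vecMulVec_self_star (ξ i)

lemma clip_proj (ν : ℝ) (Z W Φ : Matrix (Fin p) (Fin p) ℝ) (h : IsClip ν Z W)
    (hΦ : (Φ - ν • (1 : Matrix (Fin p) (Fin p) ℝ)).PosSemidef) :
    matInner (Z - W) (Φ - W) ≤ 0 := by
  obtain ⟨l, ξ, hξ, rfl, hW⟩ := h
  have hZW : ∑ i, l i • Matrix.vecMulVec (ξ i) (ξ i) - W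
      = ∑ i, (l i - max (l i) ν) • Matrix.vecMulVec (ξ i) (ξ i) := by
    rw [hW, ← Finset.sum_sub_distrib]
    simp only [sub_smul]
  rw [hZW, matInner_sum_left]
  refine Finset.sum_nonpos fun i _ => ?_
  rw [matInner_vec, Matrix.sub_mulVec, dotProduct_sub]
  have hWi : ξ i ⬝ᵥ (W *ᵥ ξ i) = max (l i) ν := by
    have : W *ᵥ ξ i = max (l i) ν • ξ i := by
      rw [hW, Matrix.sum_mulVec, Finset.sum_eq_single i]
      · rw [Matrix.smul_mulVec, Matrix.vecMulVec_mulVec, hξ]; simp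
      · intro j _ hj
        rw [Matrix.smul_mulVec, Matrix.vecMulVec_mulVec, hξ]; simp [hj]
      · simp
    rw [this, dotProduct_smul, hξ]; simp
  have hΦi : ν ≤ ξ i ⬝ᵥ (Φ *ᵥ ξ i) := by
    have := hΦ.dotProduct_mulVec_nonneg (ξ i)
    rw [Matrix.sub_mulVec, Matrix.smul_mulVec, Matrix.one_mulVec, dotProduct_sub,
      dotProduct_smul] at this
    simp only [star_trivial, hξ] at this
    simp at this
    linarith
  rw [hWi]
  rcases le_total (l i) ν with h | h
  · rw [max_eq_right h]
    nlinarith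
  · rw [max_eq_left h]; simp

lemma objective_expand {M : ℕ} (hM : 0 < M) (X : Fin M → Matrix (Fin p) (Fin p) ℝ)
    (S T : Matrix (Fin p) (Fin p) ℝ) :
    (1 / (2 * (M : ℝ))) * ∑ k, (frobNorm (S - X k)) ^ 2
      + matInner (S - (M : ℝ)⁻¹ • ∑ k, X k) (T - S)
      ≤ (1 / (2 * (M : ℝ))) * ∑ k, (frobNorm (T - X k)) ^ 2 := by
  have hM' : (0 : ℝ) < M := by exact_mod_cast hM
  have hk : ∀ k, frobNorm (S - X k) ^ 2 + 2 * matInner (S - X k) (T - S)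
      ≤ frobNorm (T - X k) ^ 2 := by
    intro k
    have e : T - X k = (S - X k) + (T - S) := by abel
    rw [e, ← norm_vecE, ← norm_vecE, ← inner_vecE, vecE_add, norm_add_sq_real]
    nlinarith [sq_nonneg ‖vecE (T - S)‖]
  have hsum := Finset.sum_le_sum fun k (_ : k ∈ Finset.univ) => hk k
  rw [Finset.sum_add_distrib, ← Finset.mul_sum] at hsum
  have hin : ∑ k, matInner (S - X k) (T - S)
      = M * matInner (S - (M : ℝ)⁻¹ • ∑ k, X k) (T - S) := by
    have hv : ∀ Y : Fin M → Matrix (Fin p) (Fin p) ℝ, vecE (∑ k, Y k) = ∑ k, vecE (Y k) := by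
      intro Y
      exact map_sum (⟨⟨vecE, rfl⟩, vecE_add⟩ : Matrix (Fin p) (Fin p) ℝ →+ _) Y _
    simp only [← inner_vecE, ← sum_inner, vecE_sub, vecE_smul, hv, Finset.sum_sub_distrib]
    rw [← real_inner_smul_left]
    congr 1
    rw [smul_sub, smul_smul, mul_inv_cancel₀ hM'.ne', one_smul]
    simp [Nat.cast_smul_eq_nsmul]
  rw [hin] at hsum
  have := mul_le_mul_of_nonneg_left hsum (show 0 ≤ 1 / (2 * (M : ℝ)) by positivity)
  have e : 1 / (2 * (M : ℝ)) * (2 * (M * matInner (S - (M : ℝ)⁻¹ • ∑ k, X k) (T - S)))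
      = matInner (S - (M : ℝ)⁻¹ • ∑ k, X k) (T - S) := by
    field_simp
  rw [mul_add, e] at this
  exact this

end matrixHelpers

/-- **Theorem 1 (convergence of the ADMM algorithm).**  Suppose a KKT point of the
constrained ensemble problem exists.  Then from any symmetric starting point, the ADMM
sequence converges to a limit `(Σ*, Φ*, Λ*)` with `Φ* = Σ*`, `Σ* ⪰ νI`, and `Σ*`
minimizes `(1/(2M)) ∑ k ‖Σ − Σ̂_k‖²_F + λ|Σ|₁` over symmetric `Σ ⪰ νI`. -/
theorem admm_converges_to_minimizer {p M : ℕ} (hM : 0 < M)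
    (lam ν τ : ℝ) (hlam : 0 ≤ lam) (hν : 0 < ν) (hτ : 0 < τ)
    (Sighat : Fin M → Matrix (Fin p) (Fin p) ℝ) (hsymm : ∀ k, (Sighat k).IsSymm)
    (Sig Phi Lam : ℕ → Matrix (Fin p) (Fin p) ℝ)
    (hseq : ∀ i, (Sig i).IsSymm ∧ (Phi i).IsSymm ∧ (Lam i).IsSymm)
    (hPhiStep : ∀ i, IsClip ν (Sig i + τ • Lam i) (Phi (i + 1)))
    (hSigStep : ∀ i, Sig (i + 1) = (τ + 1)⁻¹ •
      softThresh (τ • ((M : ℝ)⁻¹ • ∑ k, Sighat k - Lam i) + Phi (i + 1)) (lam * τ))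
    (hLamStep : ∀ i, Lam (i + 1) = Lam i - τ⁻¹ • (Phi (i + 1) - Sig (i + 1)))
    -- existence of a KKT point `(Σ̂⁺, Φ̂⁺, Λ̂⁺)`
    (hKKT : ∃ Sigp Phip Lamp : Matrix (Fin p) (Fin p) ℝ,
      Sigp.IsSymm ∧ Phip.IsSymm ∧ Lamp.IsSymm ∧ Phip = Sigp ∧
      (Phip - ν • (1 : Matrix (Fin p) (Fin p) ℝ)).PosSemidef ∧
      (∀ Φ : Matrix (Fin p) (Fin p) ℝ, Φ.IsSymm →
        (Φ - ν • (1 : Matrix (Fin p) (Fin p) ℝ)).PosSemidef →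
        matInner Lamp (Φ - Phip) ≤ 0) ∧
      (∀ j : Fin p, (Sigp - (M : ℝ)⁻¹ • ∑ k, Sighat k) j j + Lamp j j = 0) ∧
      (∀ j l : Fin p, j ≠ l →
        if Sigp j l ≠ 0 then
          (-Sigp + (M : ℝ)⁻¹ • ∑ k, Sighat k - Lamp) j l = lam * Real.sign (Sigp j l)
        else |(-Sigp + (M : ℝ)⁻¹ • ∑ k, Sighat k - Lamp) j l| ≤ lam)) :
    ∃ SigStar PhiStar LamStar : Matrix (Fin p) (Fin p) ℝ,
      Tendsto (fun i => frobNorm (Sig i - SigStar)) atTop (nhds 0) ∧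
      Tendsto (fun i => frobNorm (Phi i - PhiStar)) atTop (nhds 0) ∧
      Tendsto (fun i => frobNorm (Lam i - LamStar)) atTop (nhds 0) ∧
      PhiStar = SigStar ∧ SigStar.IsSymm ∧
      (SigStar - ν • (1 : Matrix (Fin p) (Fin p) ℝ)).PosSemidef ∧
      (∀ T : Matrix (Fin p) (Fin p) ℝ, T.IsSymm →
        (T - ν • (1 : Matrix (Fin p) (Fin p) ℝ)).PosSemidef →
        (1 / (2 * (M : ℝ))) * ∑ k, (frobNorm (SigStar - Sighat k)) ^ 2 +
            lam * offDiagL1 SigStar ≤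
          (1 / (2 * (M : ℝ))) * ∑ k, (frobNorm (T - Sighat k)) ^ 2 +
            lam * offDiagL1 T) := by
  obtain ⟨Sp, Pp, Lp, hSs, hPs, hLs, rfl, hpsd, hLC, hdiag, hoff⟩ := hKKT
  set B : Matrix (Fin p) (Fin p) ℝ := (M : ℝ)⁻¹ • ∑ k, Sighat k with hB
  have kk : ∀ T, matInner (B - Lp - Pp) (T - Pp) ≤ lam * offDiagL1 T - lam * offDiagL1 Pp := by
    intro T
    refine mat_sub lam hlam _ _ T (fun j => ?_) (fun j l hjl => ?_)
    · have := hdiag j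
      simp only [Matrix.sub_apply] at this ⊢
      linarith
    · have e : (B - Lp - Pp) = (-Pp + B - Lp) := by abel
      rw [e]
      exact hoff j l hjl
  have kseq : ∀ i T, matInner (B - Lam (i + 1) - Sig (i + 1)) (T - Sig (i + 1))
      ≤ lam * offDiagL1 T - lam * offDiagL1 (Sig (i + 1)) := by
    intro i T
    have hτ1 : τ + 1 ≠ 0 := by linarith
    have key : B - Lam (i + 1) - Sig (i + 1)
        = τ⁻¹ • ((τ • (B - Lam i) + Phi (i + 1)) - (τ + 1) • Sig (i + 1)) := by
      rw [hLamStep i]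
      ext j l
      simp only [Matrix.sub_apply, Matrix.smul_apply, Matrix.add_apply, smul_eq_mul]
      field_simp
      ring
    rw [key]
    refine mat_sub lam hlam _ _ T (fun j => ?_) (fun j l hjl => ?_)
    · rw [hSigStep i, smul_smul, mul_inv_cancel₀ hτ1, one_smul]
      simp [softThresh]
    · have := soft_scalar lam τ ((τ • (B - Lam i) + Phi (i + 1)) j l) hlam hτ
      have hs : Sig (i + 1) j l = (τ + 1)⁻¹ * (Real.sign ((τ • (B - Lam i) + Phi (i + 1)) j l)
          * max (|(τ • (B - Lam i) + Phi (i + 1)) j l| - lam * τ) 0) := by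
        rw [hSigStep i]
        simp [softThresh, hjl]
      simp only [← hs] at this
      exact this
  have hcont : Continuous fun x : EuclideanSpace ℝ (Fin p × Fin p) =>
      lam * offDiagL1 (matE x) := by
    refine continuous_const.mul (continuous_finsetSum _ fun i _ => continuous_finsetSum _ fun j _ => ?_)
    by_cases h : i = j
    · simp [h, continuous_const]
    · simp only [h, if_false, matE, Matrix.of_apply]
      fun_prop
  have main := aux_abs
    {x | (matE x).IsSymm ∧ (matE x - ν • (1 : Matrix (Fin p) (Fin p) ℝ)).PosSemidef}
    (fun x : EuclideanSpace ℝ (Fin p × Fin p) => lam * offDiagL1 (matE x)) hcont (vecE B) τ hτ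
    (fun i => vecE (Sig (i + 1))) (fun i => vecE (Lam (i + 1))) (fun i => vecE (Phi (i + 1)))
    (vecE Pp) (vecE Lp)
    (fun i T => by
      have := kseq i (matE T)
      rw [← inner_vecE] at this
      exact this)
    (fun T => by
      have := kk (matE T)
      rw [← inner_vecE] at this
      exact this)
    (fun i => ⟨(hseq _).2.1, clip_mem ν _ _ (hPhiStep (i + 1))⟩)
    (fun i Φ hΦ => by
      have := clip_proj ν _ _ (matE Φ) (hPhiStep (i + 1)) hΦ.2
      have e : Sig (i + 1) + τ • Lam (i + 1) - Phi (i + 1 + 1)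
          = τ • Lam (i + 1 + 1) + Sig (i + 1) - Sig (i + 1 + 1) := by
        rw [hLamStep (i + 1), smul_sub, smul_smul, mul_inv_cancel₀ hτ.ne', one_smul]
        abel
      rw [e, ← inner_vecE] at this
      exact this)
    (fun i => by
      have e : Phi (i + 1 + 1) = Sig (i + 1 + 1) + τ • (Lam (i + 1) - Lam (i + 1 + 1)) := by
        rw [hLamStep (i + 1), sub_sub_cancel, smul_smul, mul_inv_cancel₀ hτ.ne', one_smul]
        abel
      exact congrArg vecE e)
    ⟨hSs, hpsd⟩
    (fun Φ hΦ => by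
      have := hLC (matE Φ) hΦ.1 hΦ.2
      rw [← inner_vecE] at this
      exact this)
  obtain ⟨mS, mP, Ls, mL⟩ := main
  refine ⟨Pp, Pp, matE Ls, ?_, ?_, ?_, rfl, hSs, hpsd, ?_⟩
  · have t := tendsto_frob (fun i => Sig (i + 1)) (vecE Pp) mS
    rw [matE_vecE] at t
    exact (tendsto_add_atTop_iff_nat (f := fun i => frobNorm (Sig i - Pp)) 1).1 t
  · have t := tendsto_frob (fun i => Phi (i + 1)) (vecE Pp) mP
    rw [matE_vecE] at t
    exact (tendsto_add_atTop_iff_nat (f := fun i => frobNorm (Phi i - Pp)) 1).1 t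
  · have t := tendsto_frob (fun i => Lam (i + 1)) (Ls) mL
    exact (tendsto_add_atTop_iff_nat (f := fun i => frobNorm (Lam i - matE Ls)) 1).1 t
  · intro T hT hTp
    have a := kk T
    have b := hLC T hT hTp
    have c := objective_expand hM Sighat Pp T
    rw [← hB] at c
    have e : matInner (B - Lp - Pp) (T - Pp)
        = - matInner (Pp - B) (T - Pp) - matInner Lp (T - Pp) := by
      simp only [← inner_vecE, vecE_sub, inner_sub_left]
      ring
    linarith
end

section
/- Let Σ₀ be a real symmetric positive definite p×p matrix with smallest eigenvalue λ_min(Σ₀), let ε ∈ (0, λ_min(Σ₀)), let λ > 0, and let Σ̂₁, …, Σ̂_M be real symmetric p×p matrices such that |(Σ̂_k)_{ij} − (Σ₀)_{ij}| ≤ λ for all 1 ≤ i, j ≤ p and 1 ≤ k ≤ M. Let s₀ be the number of nonzero off-diagonal entries of Σ₀ and F(Δ) = (1/(2M))Σ_{k=1}^M ‖Δ + Σ₀ − Σ̂_k‖²_F + λ|Δ + Σ₀|₁. Then for every symmetric Δ with Δ + Σ₀ ⪰ εI and ‖Δ‖_F = 5λ√(s₀ + p), one has F(Δ) − F(0) ≥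 (5/2)λ²(s₀ + p) > 0. -/
open Matrix

/-- The number of nonzero off-diagonal entries of a real `p × p` matrix. -/
noncomputable def offDiagSupport {p : ℕ} (A : Matrix (Fin p) (Fin p) ℝ) : ℕ :=
  (Finset.univ.filter fun ij : Fin p × Fin p => ij.1 ≠ ij.2 ∧ A ij.1 ij.2 ≠ 0).card

lemma ens_entry (l d x y : ℝ) (hl : 0 < l) (h : |y - x| ≤ l) (b : Prop) [Decidable b] :
    (3 / 10) * d ^ 2 - 5 * l ^ 2 * (if b ∨ x ≠ 0 then 1 else 0) ≤
      (1 / 2) * (d + x - y) ^ 2 - (1 / 2) * (0 + x - y) ^ 2 +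
        l * ((if b then 0 else |d + x|) - (if b then 0 else |0 + x|)) := by
  have h1 : |d * (y - x)| ≤ l * |d| := by
    rw [abs_mul, mul_comm]
    exact mul_le_mul_of_nonneg_right h (abs_nonneg d)
  have h2 := (abs_le.mp h1).2
  have h3 : |x| ≤ |d + x| + |d| := by
    have := abs_sub (d + x) d
    simpa using this
  have h4 := mul_le_mul_of_nonneg_left h3 hl.le
  have h5 : |d| ^ 2 = d ^ 2 := sq_abs d
  have h6 := sq_nonneg (|d| - 5 * l)
  have h7 : 0 ≤ l * |d| := mul_nonneg hl.le (abs_nonneg d)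
  by_cases hb : b
  · simp only [hb, true_or, if_true]
    nlinarith
  · by_cases hx : x = 0
    · subst hx
      simp [hb]
      simp at h2
      nlinarith [sq_nonneg d]
    · simp only [hb, hx, ne_eq, not_false_eq_true, or_true, if_true, if_false, zero_add]
      nlinarith

lemma ens_count {p : ℕ} (A : Matrix (Fin p) (Fin p) ℝ) :
    ∑ i, ∑ j, (if i = j ∨ A i j ≠ 0 then (1 : ℝ) else 0) = (offDiagSupport A : ℝ) + p := by
  have h : ∀ i j : Fin p, (if i = j ∨ A i j ≠ 0 then (1 : ℝ) else 0) =
      (if i ≠ j ∧ A i j ≠ 0 then (1 : ℝ) else 0) + (if i = j then 1 else 0) := by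
    intro i j
    by_cases h1 : i = j <;> simp [h1]
  simp only [h, Finset.sum_add_distrib]
  congr 1
  · rw [offDiagSupport, Finset.card_filter, Nat.cast_sum, Fintype.sum_prod_type]
    simp
  · simp

lemma ens_frob {p : ℕ} (A : Matrix (Fin p) (Fin p) ℝ) :
    frobNorm A ^ 2 = ∑ i, ∑ j, (A i j) ^ 2 :=
  Real.sq_sqrt (Finset.sum_nonneg fun _ _ => Finset.sum_nonneg fun _ _ => sq_nonneg _)

/-- Under the hypotheses of the previous lower bound, for every symmetric `Δ` with
`Δ + Sig0 ⪰ εI` and `‖Δ‖_F = 5 lam √(s₀ + p)`, one has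
`F(Δ) − F(0) ≥ (5/2) lam² (s₀ + p) > 0`. -/
theorem ensemble_objective_positive_on_sphere {p M : ℕ} (hp : 0 < p) (hM : 0 < M)
    (Sig0 : Matrix (Fin p) (Fin p) ℝ) (hSig0 : Sig0.PosDef)
    (ε : ℝ) (hε : 0 < ε) (hεmin : ∀ i : Fin p, ε < hSig0.1.eigenvalues i)
    (lam : ℝ) (hlam : 0 < lam)
    (Sighat : Fin M → Matrix (Fin p) (Fin p) ℝ)
    (hsymm : ∀ k, (Sighat k).IsSymm)
    (hclose : ∀ (k : Fin M) (i j : Fin p), |Sighat k i j - Sig0 i j| ≤ lam) :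
    let s0 : ℕ := offDiagSupport Sig0
    let F : Matrix (Fin p) (Fin p) ℝ → ℝ := fun Δ =>
      (1 / (2 * (M : ℝ))) * ∑ k, (frobNorm (Δ + Sig0 - Sighat k)) ^ 2 +
        lam * offDiagL1 (Δ + Sig0)
    ∀ Δ : Matrix (Fin p) (Fin p) ℝ, Δ.IsSymm →
      (Δ + Sig0 - ε • (1 : Matrix (Fin p) (Fin p) ℝ)).PosSemidef →
      frobNorm Δ = 5 * lam * Real.sqrt ((s0 : ℝ) + (p : ℝ)) →
      F Δ - F 0 ≥ (5 / 2) * lam ^ 2 * ((s0 : ℝ) + (p : ℝ)) ∧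
      (0 : ℝ) < (5 / 2) * lam ^ 2 * ((s0 : ℝ) + (p : ℝ)) := by
  intro s0 F Δ _ _ hD
  have hpr : (0 : ℝ) < p := by exact_mod_cast hp
  have hMr : (0 : ℝ) < M := by exact_mod_cast hM
  have hN : (0 : ℝ) < (s0 : ℝ) + p := by positivity
  refine ⟨?_, by positivity⟩
  have hD2 : frobNorm Δ ^ 2 = 25 * lam ^ 2 * ((s0 : ℝ) + p) := by
    rw [hD, mul_pow, Real.sq_sqrt hN.le]; ring
  have key : ∀ k : Fin M, (5 / 2) * lam ^ 2 * ((s0 : ℝ) + p) ≤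
      (1 / 2) * frobNorm (Δ + Sig0 - Sighat k) ^ 2 -
        (1 / 2) * frobNorm (0 + Sig0 - Sighat k) ^ 2 +
        lam * (offDiagL1 (Δ + Sig0) - offDiagL1 (0 + Sig0)) := by
    intro k
    have h := Finset.sum_le_sum fun i (_ : i ∈ (Finset.univ : Finset (Fin p))) =>
      Finset.sum_le_sum fun j (_ : j ∈ (Finset.univ : Finset (Fin p))) =>
        ens_entry lam (Δ i j) (Sig0 i j) (Sighat k i j) hlam (hclose k i j) (i = j)
    simp only [Finset.sum_add_distrib, Finset.sum_sub_distrib, ← Finset.mul_sum] at h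
    rw [ens_count, ← ens_frob] at h
    simp only [ens_frob (_ - _), offDiagL1, Matrix.sub_apply, Matrix.add_apply, Matrix.zero_apply]
    change _ * _ - 5 * lam ^ 2 * ((s0 : ℝ) + p) ≤ _ at h
    rw [hD2] at h
    linarith
  have hs := Finset.sum_le_sum fun k (_ : k ∈ (Finset.univ : Finset (Fin M))) => key k
  simp only [Finset.sum_add_distrib, Finset.sum_sub_distrib, ← Finset.mul_sum,
    Finset.sum_const, Finset.card_univ, Fintype.card_fin, nsmul_eq_mul] at hs
  have hF : F Δ - F 0 = (1 / (M : ℝ)) *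
      ((1 / 2) * ∑ k, frobNorm (Δ + Sig0 - Sighat k) ^ 2 -
        (1 / 2) * ∑ k, frobNorm (0 + Sig0 - Sighat k) ^ 2 +
        M * (lam * (offDiagL1 (Δ + Sig0) - offDiagL1 (0 + Sig0)))) := by
    simp only [F]
    field_simp
    ring
  rw [hF, ge_iff_le, one_div, ← div_eq_inv_mul, le_div_iff₀ hMr]
  linarith
end
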